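/- Let 0 < α < 1, let (λ_n)_{n≥1} be positive reals, and let (ψ_n)_{n≥1} be reals with ∑_{n=1}^∞ |ψ_n| < ∞. If ∑_{n=1}^∞ ψ_n E_{α,1}(−λ_n t^α) = 0 for every real t ≥ 0, then ∑_{n=1}^∞ ψ_n/(ζ + λ_n) = 0 for every real ζ > 0 (the series converges absolutely since |1/(ζ+λ_n)| ≤ 1/ζ). -/

import Mathlib

/-- The Mittag-Leffler function `E_{α,β}(x) = ∑_{k=0}^∞ x^k / Γ(αk + β)` for real `x`,
where `1/Γ` is interpreted as its entire extension (Mathlib's `Real.Gamma` vanishes at the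
poles, so division yields `0` there). The series converges absolutely for every `x`. -/
noncomputable def mittagLeffler (α β x : ℝ) : ℝ :=
  ∑' k : ℕ, x ^ k / Real.Gamma (α * k + β)

open MeasureTheory Set Filter Topology

/-- `Γ` dominates every exponential: `R ^ x * e ^ (-R) ≤ Γ (x + 1)`. -/
theorem rpow_mul_exp_neg_le_Gamma {R x : ℝ} (hR : 0 < R) (hx : 0 ≤ x) :
    R ^ x * Real.exp (-R) ≤ Real.Gamma (x + 1) := by
  have hint := Real.GammaIntegral_convergent (s := x + 1) (by linarith)
  rw [Real.Gamma_eq_integral (by linarith), ← integral_exp_neg_Ioi, ← integral_const_mul]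
  calc ∫ t in Ioi R, R ^ x * Real.exp (-t)
      ≤ ∫ t in Ioi R, Real.exp (-t) * t ^ (x + 1 - 1) := by
        refine setIntegral_mono_on ((integrableOn_exp_neg_Ioi R).const_mul _)
          (hint.mono_set (Ioi_subset_Ioi hR.le)) measurableSet_Ioi fun t ht => ?_
        rw [add_sub_cancel_right, mul_comm]
        gcongr
        exact (mem_Ioi.1 ht).le
    _ ≤ ∫ t in Ioi 0, Real.exp (-t) * t ^ (x + 1 - 1) := by
        refine setIntegral_mono_set hint ?_ (Ioi_subset_Ioi hR.le).eventuallyLE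
        filter_upwards [ae_restrict_mem measurableSet_Ioi] with t ht
        have : 0 < t := ht
        simp only [Pi.zero_apply]
        positivity

theorem Gamma_mul_nat_add_one_pos {α : ℝ} (hα : 0 < α) (k : ℕ) :
    0 < Real.Gamma (α * k + 1) :=
  Real.Gamma_pos_of_pos (by positivity)

theorem summable_mittagLeffler {α : ℝ} (hα : 0 < α) (x : ℝ) :
    Summable fun k : ℕ => x ^ k / Real.Gamma (α * k + 1) := by
  set M : ℝ := 2 * (|x| + 1)
  have hM : 0 < M := by positivity
  set R : ℝ := M ^ (1 / α)
  have hR : 0 < R := by positivity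
  have hRk (k : ℕ) : R ^ (α * k) = M ^ k := by
    rw [← Real.rpow_mul hM.le, ← Real.rpow_natCast]
    congr 1
    field_simp
  refine Summable.of_norm_bounded (g := fun k : ℕ => Real.exp R * (1 / 2) ^ k)
    ((summable_geometric_of_lt_one (by norm_num) (by norm_num)).mul_left _) fun k => ?_
  have hG := rpow_mul_exp_neg_le_Gamma hR (x := α * k) (by positivity)
  rw [hRk, Real.exp_neg] at hG
  have hpos := Gamma_mul_nat_add_one_pos hα k
  rw [norm_div, norm_pow, Real.norm_eq_abs, Real.norm_of_nonneg hpos.le, div_le_iff₀ hpos]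
  have hexp := Real.exp_pos R
  calc |x| ^ k ≤ (M / 2) ^ k := by
        gcongr
        simp only [M]
        linarith
    _ = Real.exp R * (1 / 2) ^ k * (M ^ k * (Real.exp R)⁻¹) := by
        rw [div_pow, div_pow, one_pow]
        field_simp
    _ ≤ _ := by gcongr

theorem analyticAt_mittagLeffler {α : ℝ} (hα : 0 < α) (x : ℝ) :
    AnalyticAt ℝ (mittagLeffler α 1) x := by
  set p := FormalMultilinearSeries.ofScalars ℝ fun k : ℕ => (Real.Gamma (α * k + 1))⁻¹
  have hr : p.radius = ⊤ := by
    refine FormalMultilinearSeries.radius_eq_top_of_summable_norm _ fun r => ?_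
    refine (summable_mittagLeffler hα r).congr fun k => ?_
    rw [FormalMultilinearSeries.ofScalars_norm, norm_inv,
      Real.norm_of_nonneg (Gamma_mul_nat_add_one_pos hα k).le]
    ring
  have hp : p.sum = mittagLeffler α 1 := by
    funext y
    refine tsum_congr fun k => ?_
    rw [FormalMultilinearSeries.ofScalars_apply_eq, smul_eq_mul]
    ring
  rw [← hp]
  exact (p.hasFPowerSeriesOnBall (by simp [hr])).analyticAt_of_mem (by simp [hr])

theorem continuous_mittagLeffler {α : ℝ} (hα : 0 < α) : Continuous (mittagLeffler α 1) :=
  continuous_iff_continuousAt.2 fun x => (analyticAt_mittagLeffler hα x).continuousAt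

theorem mittagLeffler_zero {α : ℝ} : mittagLeffler α 1 0 = 1 := by
  rw [mittagLeffler, tsum_eq_single 0 fun k hk => by simp [hk]]
  simp

theorem integral_rpow_mul_sub_rpow {a b t : ℝ} (ha : 0 < a) (hb : 0 < b) (ht : 0 < t) :
    ∫ s in 0..t, s ^ (a - 1) * (t - s) ^ (b - 1) =
      t ^ (a + b - 1) * (Real.Gamma a * Real.Gamma b / Real.Gamma (a + b)) := by
  have h := Complex.betaIntegral_scaled a b ht
  rw [Complex.betaIntegral_eq_Gamma_mul_div _ _ (by simpa) (by simpa), ← Complex.ofReal_add,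
    Complex.Gamma_ofReal, Complex.Gamma_ofReal, Complex.Gamma_ofReal] at h
  apply Complex.ofReal_injective
  rw [← intervalIntegral.integral_ofReal]
  push_cast [Complex.ofReal_cpow ht.le]
  push_cast at h
  rw [← h]
  refine intervalIntegral.integral_congr fun s hs => ?_
  rw [uIcc_of_le ht.le] at hs
  rw [Complex.ofReal_cpow hs.1, Complex.ofReal_cpow (sub_nonneg.2 hs.2)]
  push_cast
  rfl

theorem intervalIntegrable_rpow_mul_sub_rpow {a b t : ℝ} (ha : 0 < a) (hb : 0 < b) (ht : 0 < t) :
    IntervalIntegrable (fun s => s ^ (a - 1) * (t - s) ^ (b - 1)) volume 0 t := by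
  refine intervalIntegral.intervalIntegrable_of_integral_ne_zero ?_
  rw [integral_rpow_mul_sub_rpow ha hb ht]
  have := Real.Gamma_pos_of_pos ha
  have := Real.Gamma_pos_of_pos hb
  have := Real.Gamma_pos_of_pos (add_pos ha hb)
  positivity

/-- The function `t ↦ E_{α,1}(c t ^ α)` solves the Volterra equation `u = 1 + c I^α u`. -/
theorem mittagLeffler_eq_one_add_integral {α : ℝ} (hα : 0 < α) {c : ℝ} (hc : c ≠ 0) {t : ℝ}
    (ht : 0 ≤ t) :
    mittagLeffler α 1 (c * t ^ α) =
      1 + c / Real.Gamma α *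
        ∫ s in 0..t, mittagLeffler α 1 (c * s ^ α) * (t - s) ^ (α - 1) := by
  rcases ht.eq_or_lt with rfl | ht
  · simp [Real.zero_rpow hα.ne', mittagLeffler_zero]
  set F : ℕ → ℝ → ℝ := fun k s =>
    c ^ k / Real.Gamma (α * k + 1) * (s ^ ((α * k + 1) - 1) * (t - s) ^ (α - 1))
  have hGα := Real.Gamma_pos_of_pos hα
  have hk (k : ℕ) : 0 < α * k + 1 := by positivity
  have hFint (k : ℕ) : IntegrableOn (F k) (Ioc 0 t) :=
    ((intervalIntegrable_iff_integrableOn_Ioc_of_le ht.le).1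
      (intervalIntegrable_rpow_mul_sub_rpow (hk k) hα ht)).const_mul _
  have hB (d : ℝ) (k : ℕ) : d ^ k / Real.Gamma (α * k + 1) *
      ∫ s in Ioc 0 t, s ^ ((α * k + 1) - 1) * (t - s) ^ (α - 1) =
      t ^ α * Real.Gamma α * ((d * t ^ α) ^ k / Real.Gamma (α * (k + 1 : ℕ) + 1)) := by
    rw [← intervalIntegral.integral_of_le ht.le, integral_rpow_mul_sub_rpow (hk k) hα ht,
      show α * k + 1 + α - 1 = α * k + α by ring,
      show α * k + 1 + α = α * (k + 1 : ℕ) + 1 by push_cast; ring, Real.rpow_add ht,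
      Real.rpow_mul ht.le, Real.rpow_natCast, mul_pow]
    have := (Gamma_mul_nat_add_one_pos hα k).ne'
    field_simp
  have hsumm (d : ℝ) : Summable fun k : ℕ =>
      t ^ α * Real.Gamma α * ((d * t ^ α) ^ k / Real.Gamma (α * (k + 1 : ℕ) + 1)) := by
    by_cases hd : d = 0
    · refine summable_of_ne_finset_zero (s := {0}) fun k hk => ?_
      have : k ≠ 0 := by simpa using hk
      simp [hd, this]
    have h := (summable_nat_add_iff 1).2 (summable_mittagLeffler hα (d * t ^ α))
    refine (h.mul_left (Real.Gamma α / d)).congr fun k => ?_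
    rw [pow_succ]
    field_simp
  have hnorm (k : ℕ) : ∫ s in Ioc 0 t, ‖F k s‖ =
      t ^ α * Real.Gamma α * ((|c| * t ^ α) ^ k / Real.Gamma (α * (k + 1 : ℕ) + 1)) := by
    rw [← hB, ← integral_const_mul]
    refine setIntegral_congr_fun measurableSet_Ioc fun s hs => ?_
    have h0 := hs.1
    have h1 := sub_nonneg.2 hs.2
    simp only [F]
    rw [norm_mul, norm_div, norm_pow, Real.norm_eq_abs,
      Real.norm_of_nonneg (Gamma_mul_nat_add_one_pos hα k).le, Real.norm_of_nonneg (by positivity)]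
  have hsum := hasSum_integral_of_summable_integral_norm hFint
    ((hsumm |c|).congr fun k => (hnorm k).symm)
  have hFsum : ∫ s in Ioc 0 t, ∑' k, F k s =
      ∫ s in 0..t, mittagLeffler α 1 (c * s ^ α) * (t - s) ^ (α - 1) := by
    rw [intervalIntegral.integral_of_le ht.le]
    refine setIntegral_congr_fun measurableSet_Ioc fun s hs => ?_
    simp only [F, mittagLeffler]
    rw [← tsum_mul_right]
    refine tsum_congr fun k => ?_
    rw [add_sub_cancel_right, Real.rpow_mul hs.1.le, Real.rpow_natCast, mul_pow]
    ring
  rw [← hFsum, ← hsum.tsum_eq, mittagLeffler, (summable_mittagLeffler hα _).tsum_eq_zero_add,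
    ← tsum_mul_left]
  congr 1
  · simp
  refine tsum_congr fun k => ?_
  simp only [F]
  rw [integral_const_mul, hB, pow_succ]
  field_simp

theorem continuous_mittagLeffler_mul_rpow {α : ℝ} (hα : 0 < α) (c : ℝ) :
    Continuous fun t : ℝ => mittagLeffler α 1 (c * t ^ α) :=
  (continuous_mittagLeffler hα).comp
    (continuous_const.mul (Real.continuous_rpow_const hα.le))

theorem intervalIntegrable_mittagLeffler_mul_sub_rpow {α : ℝ} (hα : 0 < α) (c t a b : ℝ) :
    IntervalIntegrable (fun s => mittagLeffler α 1 (c * s ^ α) * (t - s) ^ (α - 1))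
      volume a b := by
  have h : IntervalIntegrable (fun s : ℝ => s ^ (α - 1)) volume (t - a) (t - b) :=
    intervalIntegral.intervalIntegrable_rpow' (by linarith)
  have h' := h.comp_sub_left t
  simp only [sub_sub_cancel] at h'
  exact h'.continuousOn_mul (continuous_mittagLeffler_mul_rpow hα c).continuousOn

/-- The function `t ↦ E_{α,1}(-t ^ α)` cannot be nonnegative on `[0, T]` and negative on
`(T, t]`, because the kernel `s ↦ s ^ (α - 1)` of its Volterra equation is antitone. -/
theorem mittagLeffler_nonneg_of_neg_on_Ioc {α : ℝ} (hα0 : 0 < α) (hα1 : α < 1) {T t : ℝ}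
    (hT : 0 ≤ T) (hTt : T < t) (hpos : ∀ s ∈ Icc 0 T, 0 ≤ mittagLeffler α 1 (-1 * s ^ α))
    (hneg : ∀ s ∈ Ioc T t, mittagLeffler α 1 (-1 * s ^ α) < 0) :
    0 ≤ mittagLeffler α 1 (-1 * t ^ α) := by
  have hint := intervalIntegrable_mittagLeffler_mul_sub_rpow hα0 (-1)
  have hΓ := Real.Gamma_pos_of_pos hα0
  refine (hpos T ⟨hT, le_rfl⟩).trans ?_
  rw [mittagLeffler_eq_one_add_integral hα0 (by norm_num) hT,
    mittagLeffler_eq_one_add_integral hα0 (by norm_num) (hT.trans hTt.le), neg_div, neg_mul,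
    neg_mul, add_le_add_iff_left, neg_le_neg_iff,
    ← intervalIntegral.integral_add_adjacent_intervals (hint t 0 T) (hint t T t)]
  gcongr
  have h1 : ∫ s in 0..T, mittagLeffler α 1 (-1 * s ^ α) * (t - s) ^ (α - 1) ≤
      ∫ s in 0..T, mittagLeffler α 1 (-1 * s ^ α) * (T - s) ^ (α - 1) := by
    refine intervalIntegral.integral_mono_on_of_le_Ioo hT (hint t 0 T) (hint T 0 T) fun s hs => ?_
    refine mul_le_mul_of_nonneg_left ?_ (hpos s (Ioo_subset_Icc_self hs))
    exact Real.rpow_le_rpow_of_nonpos (sub_pos.2 hs.2) (by linarith) (by linarith)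
  have h2 : ∫ s in T..t, mittagLeffler α 1 (-1 * s ^ α) * (t - s) ^ (α - 1) ≤ 0 := by
    rw [intervalIntegral.integral_of_le hTt.le]
    refine setIntegral_nonpos measurableSet_Ioc fun s hs => ?_
    exact mul_nonpos_of_nonpos_of_nonneg (hneg s hs).le
      (Real.rpow_nonneg (sub_nonneg.2 hs.2) _)
  linarith

theorem mittagLeffler_neg_rpow_nonneg {α : ℝ} (hα0 : 0 < α) (hα1 : α < 1) {t : ℝ} (ht : 0 ≤ t) :
    0 ≤ mittagLeffler α 1 (-1 * t ^ α) := by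
  by_contra! hlt
  set u : ℝ → ℝ := fun s => mittagLeffler α 1 (-1 * s ^ α) with hu
  have hcont : Continuous u := continuous_mittagLeffler_mul_rpow hα0 (-1)
  set S : Set ℝ := {s | 0 ≤ s ∧ u s < 0}
  have hS : S.Nonempty := ⟨t, ht, hlt⟩
  have hSb : BddBelow S := ⟨0, fun s hs => hs.1⟩
  set T := sInf S
  have hT : 0 ≤ T := le_csInf hS fun s hs => hs.1
  have hltT : ∀ s, 0 ≤ s → s < T → 0 ≤ u s := fun s hs hsT => by
    by_contra! h
    exact (csInf_le hSb ⟨hs, h⟩).not_gt hsT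
  have huT : 0 ≤ u T := by
    rcases hT.eq_or_lt with h0 | h0
    · simp [← h0, hu, Real.zero_rpow hα0.ne', mittagLeffler_zero]
    by_contra! h
    have h1 : ∀ᶠ s in 𝓝[<] T, u s < 0 :=
      (hcont.continuousAt.eventually_lt_const h).filter_mono nhdsWithin_le_nhds
    obtain ⟨s, hs, hs'⟩ := (h1.and (Ioo_mem_nhdsLT h0)).exists
    exact (hltT s hs'.1.le hs'.2).not_gt hs
  have hfreq : ∀ ε > T, ∃ s ∈ Ioo T ε, u s < 0 := fun ε hε => by
    obtain ⟨s, hs, hsε⟩ := exists_lt_of_csInf_lt hS hε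
    refine ⟨s, ⟨(csInf_le hSb hs).lt_of_ne ?_, hsε⟩, hs.2⟩
    intro (h : T = s)
    rw [h] at huT
    exact huT.not_gt hs.2
  have han : AnalyticAt ℝ (fun x => mittagLeffler α 1 (-1 * x)) (T ^ α) :=
    (analyticAt_mittagLeffler hα0 _).fun_comp (by fun_prop)
  have htend : Tendsto (fun s : ℝ => s ^ α) (𝓝[>] T) (𝓝[≠] (T ^ α)) := by
    refine tendsto_nhdsWithin_of_tendsto_nhds_of_eventually_within _
      ((Real.continuous_rpow_const hα0.le).continuousAt.mono_left nhdsWithin_le_nhds) ?_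
    filter_upwards [self_mem_nhdsWithin] with s hs
    exact (Real.rpow_lt_rpow hT hs hα0).ne'
  rcases han.eventually_eq_zero_or_eventually_ne_zero with h | h
  · have h' : ∀ᶠ s in 𝓝[>] T, u s = 0 := htend.eventually (h.filter_mono nhdsWithin_le_nhds)
    obtain ⟨ε, hε, hsub⟩ := mem_nhdsGT_iff_exists_Ioo_subset.1 h'
    obtain ⟨s, hs, hs'⟩ := hfreq ε hε
    exact hs'.ne (hsub hs)
  · have h' : ∀ᶠ s in 𝓝[>] T, u s ≠ 0 := htend.eventually h
    obtain ⟨ε, hε, hsub⟩ := mem_nhdsGT_iff_exists_Ioo_subset.1 h'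
    obtain ⟨r, hr, hr'⟩ := hfreq ε hε
    refine hr'.not_ge (mittagLeffler_nonneg_of_neg_on_Ioc hα0 hα1 hT hr.1 (fun s hs => ?_)
      fun s hs => ?_)
    · rcases hs.2.eq_or_lt with rfl | h
      exacts [huT, hltT s hs.1 h]
    · by_contra! h
      obtain ⟨z, hz, hz0⟩ := intermediate_value_Icc' hs.2 hcont.continuousOn ⟨hr'.le, h⟩
      exact hsub ⟨hs.1.trans_le hz.1, hz.2.trans_lt hr.2⟩ hz0

theorem mittagLeffler_nonneg_of_nonpos {α : ℝ} (hα0 : 0 < α) (hα1 : α < 1) {x : ℝ} (hx : x ≤ 0) :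
    0 ≤ mittagLeffler α 1 x := by
  have h := mittagLeffler_neg_rpow_nonneg hα0 hα1
    (Real.rpow_nonneg (neg_nonneg.2 hx) α⁻¹)
  rwa [Real.rpow_inv_rpow (neg_nonneg.2 hx) hα0.ne', neg_one_mul, neg_neg] at h

theorem mittagLeffler_le_one_of_nonpos {α : ℝ} (hα0 : 0 < α) (hα1 : α < 1) {x : ℝ} (hx : x ≤ 0) :
    mittagLeffler α 1 x ≤ 1 := by
  have hx' := neg_nonneg.2 hx
  have ht := Real.rpow_nonneg hx' α⁻¹
  have h := mittagLeffler_eq_one_add_integral hα0 (c := -1) (by norm_num) ht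
  rw [Real.rpow_inv_rpow hx' hα0.ne', neg_one_mul, neg_neg] at h
  have hΓ := Real.Gamma_pos_of_pos hα0
  have hint : 0 ≤ ∫ s in 0..(-x) ^ α⁻¹,
      mittagLeffler α 1 (-1 * s ^ α) * ((-x) ^ α⁻¹ - s) ^ (α - 1) := by
    refine intervalIntegral.integral_nonneg ht fun s hs => mul_nonneg
      (mittagLeffler_neg_rpow_nonneg hα0 hα1 hs.1) (Real.rpow_nonneg (sub_nonneg.2 hs.2) _)
  rw [h, neg_div, neg_mul]
  linarith [mul_nonneg (one_div_pos.2 hΓ).le hint]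

theorem norm_mittagLeffler_le_one {α : ℝ} (hα0 : 0 < α) (hα1 : α < 1) {x : ℝ} (hx : x ≤ 0) :
    ‖mittagLeffler α 1 x‖ ≤ 1 := by
  rw [Real.norm_of_nonneg (mittagLeffler_nonneg_of_nonpos hα0 hα1 hx)]
  exact mittagLeffler_le_one_of_nonpos hα0 hα1 hx

theorem norm_exp_mul_mittagLeffler_le {α l s t : ℝ} (hα0 : 0 < α) (hα1 : α < 1) (hl : 0 < l)
    (ht : 0 < t) :
    ‖Real.exp (-s * t) * mittagLeffler α 1 (-l * t ^ α)‖ ≤ Real.exp (-s * t) := by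
  rw [norm_mul, Real.norm_of_nonneg (Real.exp_pos _).le]
  refine mul_le_of_le_one_right (Real.exp_pos _).le (norm_mittagLeffler_le_one hα0 hα1 ?_)
  have := mul_pos hl (Real.rpow_pos_of_pos ht α)
  linarith

theorem integrableOn_exp_mul_mittagLeffler {α l s : ℝ} (hα0 : 0 < α) (hα1 : α < 1) (hl : 0 < l)
    (hs : 0 < s) :
    IntegrableOn (fun t => Real.exp (-s * t) * mittagLeffler α 1 (-l * t ^ α)) (Ioi 0) := by
  have hcont := continuous_mittagLeffler_mul_rpow hα0 (-l)
  refine Integrable.mono' (integrableOn_exp_mul_Ioi (neg_neg_of_pos hs) 0)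
    (by fun_prop) ?_
  filter_upwards [ae_restrict_mem measurableSet_Ioi] with t ht
  exact norm_exp_mul_mittagLeffler_le hα0 hα1 hl ht

theorem integral_exp_neg_mul_Ioi_zero {s : ℝ} (hs : 0 < s) :
    ∫ t in Ioi 0, Real.exp (-s * t) = 1 / s := by
  rw [integral_exp_mul_Ioi (neg_neg_of_pos hs), mul_zero, Real.exp_zero, neg_div_neg_eq]

/-- The Laplace transform of `t ↦ E_{α,1}(-l t ^ α)`. -/
theorem integral_exp_mul_mittagLeffler {α l s : ℝ} (hα0 : 0 < α) (hα1 : α < 1) (hl : 0 < l)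
    (hs : 0 < s) :
    ∫ t in Ioi 0, Real.exp (-s * t) * mittagLeffler α 1 (-l * t ^ α) =
      s ^ α / s / (s ^ α + l) := by
  have hΓ := Real.Gamma_pos_of_pos hα0
  have hu := integrableOn_exp_mul_mittagLeffler hα0 hα1 hl hs
  have hkint : ∫ t in Ioi 0, Real.exp (-s * t) * t ^ (α - 1) = Real.Gamma α / s ^ α := by
    have h := Real.integral_rpow_mul_exp_neg_mul_Ioi hα0 hs
    simp_rw [mul_comm (_ ^ (α - 1) : ℝ), ← neg_mul] at h
    rw [h, Real.div_rpow zero_le_one hs.le, Real.one_rpow]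
    ring
  have hk : IntegrableOn (fun t => Real.exp (-s * t) * t ^ (α - 1)) (Ioi 0) := by
    refine not_imp_comm.1 integral_undef ?_
    rw [hkint]
    positivity
  have hconv := integral_posConvolution hu hk (ContinuousLinearMap.mul ℝ ℝ)
  simp only [ContinuousLinearMap.mul_apply'] at hconv
  rw [hkint] at hconv
  have hinner : ∀ x ∈ Ioi (0 : ℝ),
      ∫ t in 0..x, Real.exp (-s * t) * mittagLeffler α 1 (-l * t ^ α) *
        (Real.exp (-s * (x - t)) * (x - t) ^ (α - 1)) =
      Real.Gamma α / l *
        (Real.exp (-s * x) - Real.exp (-s * x) * mittagLeffler α 1 (-l * x ^ α)) := by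
    intro x hx
    rw [mittagLeffler_eq_one_add_integral hα0 (neg_ne_zero.2 hl.ne') (le_of_lt hx)]
    trans Real.exp (-s * x) *
      ∫ t in 0..x, mittagLeffler α 1 (-l * t ^ α) * (x - t) ^ (α - 1)
    · rw [← intervalIntegral.integral_const_mul]
      congr 1 with t
      rw [show -s * x = -s * t + -s * (x - t) by ring, Real.exp_add]
      ring
    · field_simp
      ring
  rw [setIntegral_congr_fun measurableSet_Ioi hinner, integral_const_mul,
    integral_sub (integrableOn_exp_mul_Ioi (neg_neg_of_pos hs) 0) hu,
    integral_exp_neg_mul_Ioi_zero hs] at hconv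
  have hsα := Real.rpow_pos_of_pos hs α
  field_simp at hconv ⊢
  linarith

/-- Let `0 < α < 1`, `(λ_n)` positive and `(ψ_n)` absolutely summable. If
`∑_n ψ_n E_{α,1}(-λ_n t^α) = 0` for every `t ≥ 0`, then `∑_n ψ_n/(ζ + λ_n) = 0` for
every real `ζ > 0`. -/
theorem resolvent_sum_vanishes_of_mittagLeffler_sum_vanishes
    (α : ℝ) (hα0 : 0 < α) (hα1 : α < 1)
    (lam ψ : ℕ → ℝ) (hlam : ∀ n, 0 < lam n)
    (hsum : Summable (fun n => |ψ n|))
    (hvanish : ∀ t : ℝ, 0 ≤ t → ∑' n, ψ n * mittagLeffler α 1 (-lam n * t ^ α) = 0) :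
    ∀ ζ : ℝ, 0 < ζ → ∑' n, ψ n / (ζ + lam n) = 0 := by
  intro ζ hζ
  set s : ℝ := ζ ^ α⁻¹
  have hs : 0 < s := Real.rpow_pos_of_pos hζ _
  have hsα : s ^ α = ζ := Real.rpow_inv_rpow hζ.le hα0.ne'
  have hint (n : ℕ) := integrableOn_exp_mul_mittagLeffler hα0 hα1 (hlam n) hs
  have hnorm : Summable fun n => ∫ t in Ioi 0,
      ‖ψ n * (Real.exp (-s * t) * mittagLeffler α 1 (-lam n * t ^ α))‖ := by
    refine Summable.of_nonneg_of_le (fun n => integral_nonneg fun t => norm_nonneg _)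
      (fun n => ?_) (hsum.mul_right (1 / s))
    simp_rw [norm_mul (ψ n)]
    rw [integral_const_mul, Real.norm_eq_abs, ← integral_exp_neg_mul_Ioi_zero hs]
    refine mul_le_mul_of_nonneg_left ?_ (abs_nonneg _)
    exact setIntegral_mono_on (hint n).norm (integrableOn_exp_mul_Ioi (neg_neg_of_pos hs) 0)
      measurableSet_Ioi fun t ht => norm_exp_mul_mittagLeffler_le hα0 hα1 (hlam n) ht
  have hswap := (hasSum_integral_of_summable_integral_norm
    (fun n => (hint n).const_mul (ψ n)) hnorm).tsum_eq
  have hzero : ∫ t in Ioi 0,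
      ∑' n, ψ n * (Real.exp (-s * t) * mittagLeffler α 1 (-lam n * t ^ α)) = 0 := by
    refine setIntegral_eq_zero_of_forall_eq_zero fun t ht => ?_
    simp_rw [mul_left_comm (ψ _)]
    rw [tsum_mul_left, hvanish t (le_of_lt ht), mul_zero]
  have hterm (n : ℕ) :
      ∫ t in Ioi 0, ψ n * (Real.exp (-s * t) * mittagLeffler α 1 (-lam n * t ^ α)) =
        ζ / s * (ψ n / (ζ + lam n)) := by
    rw [integral_const_mul, integral_exp_mul_mittagLeffler hα0 hα1 (hlam n) hs, hsα]
    ring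
  rw [hzero, tsum_congr hterm, tsum_mul_left] at hswap
  exact (mul_eq_zero.1 hswap).resolve_left (by positivity)
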